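/- Let μ be a finite Borel measure on ℝ² with compact support contained in a closed square Π with sides parallel to the coordinate axes, and assume μ(Π) is a positive integer. Assume further that for every line L parallel to either side of Π, there is at most one point p ∈ L with 0 < μ({p}) < 1, and for any such point μ(L ∖ {p}) = 0. Then there exist a countable family of closed rectangles Π_k ⊂ Π with sides parallel to the sides of Π and Borel measures μ_k such that: (1) supp μ_k ⊂ Π_k; (2) μ_k(Π_k) = 1 for every k and Σ_k μ_k = μ; (3) the interiors of the convex hulls of the supports of the μ_k are pairwise disjoint; (4) for every k the ratio of the side lengths of Π_k lies in the interval [1/3, 3]; (5) every point of the plane belongs to the interiors of at most 4 of the rectangles Π_k. -/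

import Mathlib

open MeasureTheory
open scoped ENNReal

/-- The closed support of a Borel measure: points all of whose open neighbourhoods have
positive measure. -/
def measSupport {X : Type*} [TopologicalSpace X] [MeasurableSpace X] (μ : Measure X) : Set X :=
  {x | ∀ U : Set X, IsOpen U → x ∈ U → 0 < μ U}

section

open Set

/-- A finite measure can be cut at any prescribed mass by a level set of `f`; the mass of the level
set itself is shared between the two parts. -/
theorem exists_levelCut {α : Type*} [MeasurableSpace α] (μ : Measure α) [IsFiniteMeasure μ]
    {f : α → ℝ} (hf : Measurable f) {a b : ℝ} (hab : a ≤ b) (ha : μ {p | f p < a} = 0)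
    (hb : μ {p | b < f p} = 0) {m : ℝ≥0∞} (hm : m ≤ μ univ) :
    ∃ c, a ≤ c ∧ c ≤ b ∧ ∃ μ₁ μ₂ : Measure α, μ₁ + μ₂ = μ ∧ μ₁ univ = m ∧
      μ₁ {p | c < f p} = 0 ∧ μ₂ {p | f p < c} = 0 := by
  set A : Set ℝ := {t | a ≤ t ∧ m ≤ μ {p | f p ≤ t}}
  have hbA : b ∈ A := by
    refine ⟨hab, hm.trans ?_⟩
    have h : (univ : Set α) ⊆ {p | f p ≤ b} ∪ {p | b < f p} := fun p _ => le_or_gt (f p) b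
    calc μ univ ≤ μ {p | f p ≤ b} + μ {p | b < f p} := (measure_mono h).trans (measure_union_le _ _)
      _ = μ {p | f p ≤ b} := by rw [hb, add_zero]
  have hAb : BddBelow A := ⟨a, fun t ht => ht.1⟩
  obtain ⟨c, hc⟩ : ∃ c, c = sInf A := ⟨_, rfl⟩
  have hac : a ≤ c := hc ▸ le_csInf ⟨b, hbA⟩ fun t ht => ht.1
  have hcb : c ≤ b := hc ▸ csInf_le hAb hbA
  obtain ⟨u, hu_anti, hu_gt, hu_lim⟩ := exists_seq_strictAnti_tendsto c
  obtain ⟨v, hv_mono, hv_lt, hv_lim⟩ := exists_seq_strictMono_tendsto c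
  have hle : m ≤ μ {p | f p ≤ c} := by
    have hInter : {p | f p ≤ c} = ⋂ n, {p | f p ≤ u n} := by
      ext p
      simp only [mem_ofPred_eq, mem_iInter]
      exact ⟨fun h n => h.trans (hu_gt n).le, fun h => ge_of_tendsto' hu_lim h⟩
    have hanti : Antitone fun n => {p | f p ≤ u n} :=
      fun i j hij p (hp : f p ≤ u j) => hp.trans (hu_anti.antitone hij)
    rw [hInter, hanti.measure_iInter
      (fun n => (measurableSet_le hf measurable_const).nullMeasurableSet)
      ⟨0, measure_ne_top _ _⟩]
    refine le_iInf fun n => ?_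
    obtain ⟨t, ht, htu⟩ := exists_lt_of_csInf_lt ⟨b, hbA⟩ (hc ▸ hu_gt n)
    exact ht.2.trans (measure_mono fun p (hp : f p ≤ t) => hp.trans htu.le)
  have hlt : μ {p | f p < c} ≤ m := by
    have hUnion : {p | f p < c} = ⋃ n, {p | f p ≤ v n} := by
      ext p
      simp only [mem_ofPred_eq, mem_iUnion]
      refine ⟨fun h => ?_, fun ⟨n, h⟩ => h.trans_lt (hv_lt n)⟩
      obtain ⟨n, hn⟩ := (hv_lim.eventually (lt_mem_nhds h)).exists
      exact ⟨n, le_of_lt hn⟩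
    have hmono : Monotone fun n => {p | f p ≤ v n} :=
      fun i j hij p (hp : f p ≤ v i) => hp.trans (hv_mono.monotone hij)
    rw [hUnion, hmono.measure_iUnion]
    refine iSup_le fun n => ?_
    by_cases han : a ≤ v n
    · by_contra! h
      exact absurd (hc ▸ csInf_le hAb ⟨han, h.le⟩) (not_le.2 (hv_lt n))
    · have h : μ {p | f p ≤ v n} = 0 :=
        measure_mono_null (fun p (hp : f p ≤ v n) => hp.trans_lt (not_le.1 han)) ha
      exact h ▸ zero_le
  have hmlt : MeasurableSet {p | f p < c} := measurableSet_lt hf measurable_const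
  have hmeq : MeasurableSet {p | f p = c} := measurableSet_eq_fun hf measurable_const
  have hmgt : MeasurableSet {p | c < f p} := measurableSet_lt measurable_const hf
  have hle' : m - μ {p | f p < c} ≤ μ {p | f p = c} := by
    rw [tsub_le_iff_left]
    refine hle.trans ((measure_mono fun p (hp : f p ≤ c) => ?_).trans (measure_union_le _ _))
    exact hp.lt_or_eq
  set θ : ℝ≥0∞ := (m - μ {p | f p < c}) / μ {p | f p = c}
  have hθ1 : θ ≤ 1 := ENNReal.div_le_of_le_mul (by rwa [one_mul])
  have hθm : θ * μ {p | f p = c} = m - μ {p | f p < c} :=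
    ENNReal.div_mul_cancel' (fun h => le_zero_iff.1 (h ▸ hle')) fun h => absurd h (measure_ne_top _ _)
  refine ⟨c, hac, hcb, μ.restrict {p | f p < c} + θ • μ.restrict {p | f p = c},
    μ.restrict {p | c < f p} + (1 - θ) • μ.restrict {p | f p = c}, ?_, ?_, ?_, ?_⟩
  · have h1 : μ.restrict {p | f p < c} + μ.restrict {p | f p = c} + μ.restrict {p | c < f p} = μ := by
      rw [← Measure.restrict_union _ hmeq, ← Measure.restrict_union _ hmgt]
      · convert Measure.restrict_univ
        ext p
        simp only [mem_union, mem_ofPred_eq, mem_univ, iff_true, or_assoc, eq_comm]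
        have := lt_trichotomy (f p) c
        tauto
      · refine disjoint_left.2 fun p hp hp' => ?_
        rcases hp with hp | hp <;> simp only [mem_ofPred_eq] at hp hp' <;> linarith
      · refine disjoint_left.2 fun p hp hp' => ?_
        simp only [mem_ofPred_eq] at hp hp'
        linarith
    have h2 : θ • μ.restrict {p | f p = c} + (1 - θ) • μ.restrict {p | f p = c} =
        μ.restrict {p | f p = c} := by
      rw [← add_smul, add_tsub_cancel_of_le hθ1, one_smul]
    calc _ = μ.restrict {p | f p < c} + (θ • μ.restrict {p | f p = c} +
          (1 - θ) • μ.restrict {p | f p = c}) + μ.restrict {p | c < f p} := by abel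
      _ = μ := by rw [h2, h1]
  · simp only [Measure.add_apply, Measure.smul_apply, Measure.restrict_apply_univ, smul_eq_mul, hθm]
    exact add_tsub_cancel_of_le hlt
  · simp only [Measure.add_apply, Measure.smul_apply, smul_eq_mul, Measure.restrict_apply hmgt]
    have h1 : {p | c < f p} ∩ {p | f p < c} = ∅ := by
      ext p; simp only [mem_inter_iff, mem_ofPred_eq, mem_empty_iff_false, iff_false]
      intro h; linarith [h.1, h.2]
    have h2 : {p | c < f p} ∩ {p | f p = c} = ∅ := by
      ext p; simp only [mem_inter_iff, mem_ofPred_eq, mem_empty_iff_false, iff_false]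
      intro h; linarith [h.1, h.2]
    simp [h1, h2]
  · simp only [Measure.add_apply, Measure.smul_apply, smul_eq_mul, Measure.restrict_apply hmlt]
    have h1 : {p | f p < c} ∩ {p | c < f p} = ∅ := by
      ext p; simp only [mem_inter_iff, mem_ofPred_eq, mem_empty_iff_false, iff_false]
      intro h; linarith [h.1, h.2]
    have h2 : {p | f p < c} ∩ {p | f p = c} = ∅ := by
      ext p; simp only [mem_inter_iff, mem_ofPred_eq, mem_empty_iff_false, iff_false]
      intro h; linarith [h.1, h.2]
    simp [h1, h2]

/-- `f` and `g` are the two coordinates of the plane, in some order. -/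
def IsCoordPair (f g : ℝ × ℝ → ℝ) : Prop :=
  (f = Prod.fst ∧ g = Prod.snd) ∨ (f = Prod.snd ∧ g = Prod.fst)

namespace IsCoordPair

variable {f g : ℝ × ℝ → ℝ}

theorem symm (h : IsCoordPair f g) : IsCoordPair g f := by
  rcases h with ⟨rfl, rfl⟩ | ⟨rfl, rfl⟩
  exacts [Or.inr ⟨rfl, rfl⟩, Or.inl ⟨rfl, rfl⟩]

theorem measurable (h : IsCoordPair f g) : Measurable f := by
  rcases h with ⟨rfl, rfl⟩ | ⟨rfl, rfl⟩
  exacts [measurable_fst, measurable_snd]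

theorem continuous (h : IsCoordPair f g) : Continuous f := by
  rcases h with ⟨rfl, rfl⟩ | ⟨rfl, rfl⟩
  exacts [continuous_fst, continuous_snd]

theorem isOpenMap (h : IsCoordPair f g) : IsOpenMap f := by
  rcases h with ⟨rfl, rfl⟩ | ⟨rfl, rfl⟩
  exacts [isOpenMap_fst, isOpenMap_snd]

theorem isLinearMap (h : IsCoordPair f g) : IsLinearMap ℝ f := by
  rcases h with ⟨rfl, rfl⟩ | ⟨rfl, rfl⟩
  exacts [(LinearMap.fst ℝ ℝ ℝ).isLinear, (LinearMap.snd ℝ ℝ ℝ).isLinear]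

theorem interior_preimage (h : IsCoordPair f g) (s : Set ℝ) :
    interior (f ⁻¹' s) = f ⁻¹' interior s :=
  (h.isOpenMap.preimage_interior_eq_interior_preimage h.continuous s).symm

end IsCoordPair

/-- The rectangle `a ≤ f ≤ b`, `c ≤ g ≤ d`. -/
def coordBox (f g : ℝ × ℝ → ℝ) (a b c d : ℝ) : Set (ℝ × ℝ) :=
  {p | (a ≤ f p ∧ f p ≤ b) ∧ (c ≤ g p ∧ g p ≤ d)}

theorem mem_coordBox {f g : ℝ × ℝ → ℝ} {a b c d : ℝ} {p : ℝ × ℝ} :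
    p ∈ coordBox f g a b c d ↔ (a ≤ f p ∧ f p ≤ b) ∧ (c ≤ g p ∧ g p ≤ d) := Iff.rfl

theorem coordBox_comm (f g : ℝ × ℝ → ℝ) (a b c d : ℝ) :
    coordBox f g a b c d = coordBox g f c d a b := by
  ext p; exact and_comm

theorem coordBox_subset {f g : ℝ × ℝ → ℝ} {a b c d a' b' c' d' : ℝ} (ha : a' ≤ a) (hb : b ≤ b')
    (hc : c' ≤ c) (hd : d ≤ d') : coordBox f g a b c d ⊆ coordBox f g a' b' c' d' :=
  fun _ hp => ⟨⟨ha.trans hp.1.1, hp.1.2.trans hb⟩, ⟨hc.trans hp.2.1, hp.2.2.trans hd⟩⟩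

theorem mem_interior_coordBox {f g : ℝ × ℝ → ℝ} (h : IsCoordPair f g) {a b c d : ℝ} {p : ℝ × ℝ} :
    p ∈ interior (coordBox f g a b c d) ↔ (a < f p ∧ f p < b) ∧ (c < g p ∧ g p < d) := by
  have hbox : coordBox f g a b c d = f ⁻¹' Icc a b ∩ g ⁻¹' Icc c d := rfl
  rw [hbox, interior_inter, h.interior_preimage, h.symm.interior_preimage, interior_Icc,
    interior_Icc]
  rfl

theorem measure_compl_coordBox {f g : ℝ × ℝ → ℝ} {a b c d : ℝ} {μ : Measure (ℝ × ℝ)}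
    (ha : μ {p | f p < a} = 0) (hb : μ {p | b < f p} = 0) (hc : μ {p | g p < c} = 0)
    (hd : μ {p | d < g p} = 0) : μ (coordBox f g a b c d)ᶜ = 0 := by
  refine measure_mono_null (t := ({p | f p < a} ∪ {p | b < f p}) ∪ ({p | g p < c} ∪ {p | d < g p}))
    (fun p hp => ?_) (by simp only [measure_union_null_iff]; exact ⟨⟨ha, hb⟩, hc, hd⟩)
  by_contra hn
  simp only [mem_union, mem_ofPred_eq, not_or, not_lt] at hn
  exact hp hn

/-- A closed axis-parallel rectangle whose side ratio lies in `[1/3, 3]`. -/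
def IsFatRect (P : Set (ℝ × ℝ)) : Prop :=
  ∃ a b : ℝ × ℝ, a ≤ b ∧ P = Icc a b ∧ b.1 - a.1 ≤ 3 * (b.2 - a.2) ∧ b.2 - a.2 ≤ 3 * (b.1 - a.1)

theorem isFatRect_coordBox {f g : ℝ × ℝ → ℝ} (h : IsCoordPair f g) {a b c d : ℝ} (hab : a ≤ b)
    (hcd : c ≤ d) (h₁ : b - a ≤ 3 * (d - c)) (h₂ : d - c ≤ 3 * (b - a)) :
    IsFatRect (coordBox f g a b c d) := by
  rcases h with ⟨rfl, rfl⟩ | ⟨rfl, rfl⟩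
  · refine ⟨(a, c), (b, d), ⟨hab, hcd⟩, ?_, h₁, h₂⟩
    ext p
    simp only [coordBox, mem_ofPred_eq, mem_Icc, Prod.le_def]
    tauto
  · refine ⟨(c, a), (d, b), ⟨hcd, hab⟩, ?_, h₂, h₁⟩
    ext p
    simp only [coordBox, mem_ofPred_eq, mem_Icc, Prod.le_def]
    tauto

/-- The two measures live on opposite sides of an axis-parallel line. -/
def AxisSeparated (ν ν' : Measure (ℝ × ℝ)) : Prop :=
  ∃ f g c, IsCoordPair f g ∧
    ((ν {p | c < f p} = 0 ∧ ν' {p | f p < c} = 0) ∨ (ν' {p | c < f p} = 0 ∧ ν {p | f p < c} = 0))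

theorem AxisSeparated.symm {ν ν' : Measure (ℝ × ℝ)} (h : AxisSeparated ν ν') :
    AxisSeparated ν' ν := by
  obtain ⟨f, g, c, hfg, h⟩ := h
  exact ⟨f, g, c, hfg, Or.symm h⟩

theorem measSupport_subset_of_isClosed {X : Type*} [TopologicalSpace X] [MeasurableSpace X]
    {μ : Measure X} {C : Set X} (hC : IsClosed C) (h : μ Cᶜ = 0) : measSupport μ ⊆ C := by
  intro p hp
  by_contra hpC
  exact (hp Cᶜ hC.isOpen_compl hpC).ne' h

theorem AxisSeparated.disjoint_interior_convexHull {ν ν' : Measure (ℝ × ℝ)}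
    (h : AxisSeparated ν ν') : Disjoint (interior (convexHull ℝ (measSupport ν)))
      (interior (convexHull ℝ (measSupport ν'))) := by
  wlog h' : ∃ f g c, IsCoordPair f g ∧ (ν {p | c < f p} = 0 ∧ ν' {p | f p < c} = 0)
    generalizing ν ν'
  · obtain ⟨f, g, c, hfg, h1 | h1⟩ := h
    · exact absurd ⟨f, g, c, hfg, h1⟩ h'
    · exact (this (AxisSeparated.symm ⟨f, g, c, hfg, Or.inr h1⟩) ⟨f, g, c, hfg, h1⟩).symm
  obtain ⟨f, g, c, hfg, h1, h2⟩ := h'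
  have hν : convexHull ℝ (measSupport ν) ⊆ f ⁻¹' Iic c := by
    refine convexHull_min (measSupport_subset_of_isClosed (isClosed_Iic.preimage hfg.continuous) ?_)
      ((convex_Iic c).is_linear_preimage hfg.isLinearMap)
    convert h1 using 2
    ext p; simp
  have hν' : convexHull ℝ (measSupport ν') ⊆ f ⁻¹' Ici c := by
    refine convexHull_min (measSupport_subset_of_isClosed (isClosed_Ici.preimage hfg.continuous) ?_)
      ((convex_Ici c).is_linear_preimage hfg.isLinearMap)
    convert h2 using 2
    ext p; simp
  refine Disjoint.mono (interior_mono hν) (interior_mono hν') ?_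
  rw [hfg.interior_preimage, hfg.interior_preimage, interior_Iic, interior_Ici]
  exact (Iio_disjoint_Ioi_same).preimage f

/-- `μ` splits into `n` pairwise separated unit measures, carried by fat rectangles inside `E` whose
interiors cover each point `p` at most `F p` times. -/
def HasFatPartition (μ : Measure (ℝ × ℝ)) (n : ℕ) (E : Set (ℝ × ℝ)) (F : ℝ × ℝ → ℕ) : Prop :=
  ∃ (ι : Type) (_ : Fintype ι) (P : ι → Set (ℝ × ℝ)) (ν : ι → Measure (ℝ × ℝ)),
    Fintype.card ι = n ∧
    (∀ k, IsFatRect (P k) ∧ P k ⊆ E ∧ ν k (P k)ᶜ = 0 ∧ ν k univ = 1) ∧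
    ∑ k, ν k = μ ∧ (Pairwise fun k l => AxisSeparated (ν k) (ν l)) ∧
    ∀ p, ∑ k, (interior (P k)).indicator (fun _ => 1) p ≤ F p

namespace HasFatPartition

variable {μ μ₁ μ₂ : Measure (ℝ × ℝ)} {n n₁ n₂ : ℕ} {E E' : Set (ℝ × ℝ)} {F F' F₁ F₂ : ℝ × ℝ → ℕ}

theorem mono (h : HasFatPartition μ n E F) (hE : E ⊆ E') (hF : ∀ p, F p ≤ F' p) :
    HasFatPartition μ n E' F' := by
  obtain ⟨ι, _, P, ν, hcard, hP, hsum, hsep, hmult⟩ := h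
  exact ⟨ι, _, P, ν, hcard, fun k => ⟨(hP k).1, (hP k).2.1.trans hE, (hP k).2.2⟩, hsum, hsep,
    fun p => (hmult p).trans (hF p)⟩

theorem of_measure_univ_eq_zero (h : μ univ = 0) : HasFatPartition μ 0 E F :=
  ⟨Empty, inferInstance, fun _ => ∅, fun _ => 0, rfl, fun k => k.elim,
    by simp [Measure.measure_univ_eq_zero.1 h], fun k => k.elim, fun p => by simp⟩

theorem single (hE : IsFatRect E) (h : μ Eᶜ = 0) (h₁ : μ univ = 1) :
    HasFatPartition μ 1 E ((interior E).indicator fun _ => 1) :=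
  ⟨Unit, inferInstance, fun _ => E, fun _ => μ, rfl, fun _ => ⟨hE, subset_rfl, h, h₁⟩, by simp,
    fun _ _ h => absurd rfl h, fun p => by simp⟩

theorem add (h₁ : HasFatPartition μ₁ n₁ E F₁) (h₂ : HasFatPartition μ₂ n₂ E F₂)
    {f g : ℝ × ℝ → ℝ} {c : ℝ} (hfg : IsCoordPair f g) (hc₁ : μ₁ {p | c < f p} = 0)
    (hc₂ : μ₂ {p | f p < c} = 0) : HasFatPartition (μ₁ + μ₂) (n₁ + n₂) E (F₁ + F₂) := by
  obtain ⟨ι₁, _, P₁, ν₁, hcard₁, hP₁, rfl, hsep₁, hmult₁⟩ := h₁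
  obtain ⟨ι₂, _, P₂, ν₂, hcard₂, hP₂, rfl, hsep₂, hmult₂⟩ := h₂
  have hsep : ∀ k l, AxisSeparated (ν₁ k) (ν₂ l) := by
    intro k l
    rw [Measure.finsetSum_apply, Finset.sum_eq_zero_iff] at hc₁ hc₂
    exact ⟨f, g, c, hfg, Or.inl ⟨hc₁ k (Finset.mem_univ k), hc₂ l (Finset.mem_univ l)⟩⟩
  refine ⟨ι₁ ⊕ ι₂, inferInstance, Sum.elim P₁ P₂, Sum.elim ν₁ ν₂, by simp [hcard₁, hcard₂], ?_,
    by simp, ?_, fun p => ?_⟩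
  · rintro (k | k)
    exacts [hP₁ k, hP₂ k]
  · rintro (k | k) (l | l) hkl
    · exact hsep₁ fun h => hkl (congrArg _ h)
    · exact hsep k l
    · exact (hsep l k).symm
    · exact hsep₂ fun h => hkl (congrArg _ h)
  · simpa using add_le_add (hmult₁ p) (hmult₂ p)

end HasFatPartition

open Classical in
/-- The covering bound for rectangles inside `E` partitioning a measure carried by `S`: at most `2`
over `S` and at most `1` over the rest of `E`. -/
noncomputable def coverBound (S E : Set (ℝ × ℝ)) (p : ℝ × ℝ) : ℕ :=
  if p ∈ interior E then if p ∈ S then 2 else 1 else 0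

theorem coverBound_mono {S E E' : Set (ℝ × ℝ)} (h : E ⊆ E') (p : ℝ × ℝ) :
    coverBound S E p ≤ coverBound S E' p := by
  have := @interior_mono _ _ _ _ h p
  unfold coverBound
  split_ifs <;> first | omega | tauto

theorem exists_intermediate_interval {u₀ u₁ x₀ x₁ t : ℝ} (h₀ : u₀ ≤ x₀) (h₁ : x₁ ≤ u₁)
    (ht₀ : x₁ - x₀ ≤ t) (ht₁ : t ≤ u₁ - u₀) :
    ∃ v₀ v₁, u₀ ≤ v₀ ∧ v₀ ≤ x₀ ∧ x₁ ≤ v₁ ∧ v₁ ≤ u₁ ∧ v₁ - v₀ = t := by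
  rcases le_total (x₁ - u₀) t with h | h
  · exact ⟨u₀, u₀ + t, le_rfl, h₀, by linarith, by linarith, by ring⟩
  · exact ⟨x₁ - t, x₁, by linarith, by linarith, le_rfl, h₁, by ring⟩

open Classical in
theorem coverBound_coordBox {f g : ℝ × ℝ → ℝ} (hfg : IsCoordPair f g) {u₀ u₁ x₀ x₁ y₀ y₁ : ℝ}
    (p : ℝ × ℝ) :
    coverBound (coordBox f g x₀ x₁ y₀ y₁) (coordBox f g u₀ u₁ y₀ y₁) p =
      if (u₀ < f p ∧ f p < u₁) ∧ (y₀ < g p ∧ g p < y₁) then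
        if x₀ ≤ f p ∧ f p ≤ x₁ then 2 else 1 else 0 := by
  unfold coverBound
  simp only [mem_interior_coordBox hfg, mem_coordBox]
  split_ifs <;> grind

/-- The measure `μ` gives no mass to the complement of the rectangle `a ≤ f ≤ b`, `c ≤ g ≤ d`. -/
structure IsCarried (μ : Measure (ℝ × ℝ)) (f g : ℝ × ℝ → ℝ) (a b c d : ℝ) : Prop where
  fst_left : μ {p | f p < a} = 0
  fst_right : μ {p | b < f p} = 0
  snd_left : μ {p | g p < c} = 0
  snd_right : μ {p | d < g p} = 0

namespace IsCarried

variable {μ ν : Measure (ℝ × ℝ)} {f g : ℝ × ℝ → ℝ} {a b c d : ℝ}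

theorem swap (h : IsCarried μ f g a b c d) : IsCarried μ g f c d a b :=
  ⟨h.3, h.4, h.1, h.2⟩

theorem mono_measure (h : IsCarried μ f g a b c d) (hν : ν ≤ μ) : IsCarried ν f g a b c d :=
  have key : ∀ s, μ s = 0 → ν s = 0 := fun s hs => le_zero_iff.1 (hs ▸ hν s)
  ⟨key _ h.1, key _ h.2, key _ h.3, key _ h.4⟩

theorem compl_coordBox (h : IsCarried μ f g a b c d) {a' b' : ℝ} (ha : a' ≤ a) (hb : b ≤ b') :
    μ (coordBox f g a' b' c d)ᶜ = 0 :=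
  measure_compl_coordBox (measure_mono_null (fun _ hp => lt_of_lt_of_le hp ha) h.1)
    (measure_mono_null (fun _ hp => lt_of_le_of_lt hb hp) h.2) h.3 h.4

end IsCarried

/-- Every measure of mass `n` carried by a rectangle `[x₀, x₁] × [y₀, y₁]` has a fat partition in any
fat rectangle `[u₀, u₁] × [y₀, y₁]` extending it in one direction. -/
def PartitionsInExtensions (n : ℕ) : Prop :=
  ∀ ⦃f g : ℝ × ℝ → ℝ⦄, IsCoordPair f g → ∀ ⦃μ : Measure (ℝ × ℝ)⦄ ⦃x₀ x₁ u₀ u₁ y₀ y₁ : ℝ⦄,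
    u₀ ≤ x₀ → x₀ ≤ x₁ → x₁ ≤ u₁ → y₀ ≤ y₁ → u₁ - u₀ ≤ 3 * (y₁ - y₀) → y₁ - y₀ ≤ 3 * (u₁ - u₀) →
    IsCarried μ f g x₀ x₁ y₀ y₁ → μ univ = n →
    HasFatPartition μ n (coordBox f g u₀ u₁ y₀ y₁)
      (coverBound (coordBox f g x₀ x₁ y₀ y₁) (coordBox f g u₀ u₁ y₀ y₁))

open Classical in
/-- The covering bound obtained for a measure carried by `[x₀, x₁] × [z₀, z₁]` partitioned inside
`[u₀, u₁] × [Z₀, Z₁]`, when rectangles may leave `[x₀, x₁]` or `[z₀, z₁]` but not both. -/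
noncomputable def crossBound (f g : ℝ × ℝ → ℝ) (x₀ x₁ u₀ u₁ z₀ z₁ Z₀ Z₁ : ℝ) (p : ℝ × ℝ) : ℕ :=
  if (u₀ < f p ∧ f p < u₁) ∧ (Z₀ < g p ∧ g p < Z₁) then
    (if x₀ ≤ f p ∧ f p ≤ x₁ then 1 else 0) + (if z₀ ≤ g p ∧ g p ≤ z₁ then 1 else 0) else 0

theorem PartitionsInExtensions.crossBound {n : ℕ} (h : PartitionsInExtensions n)
    {f g : ℝ × ℝ → ℝ} (hfg : IsCoordPair f g) {μ : Measure (ℝ × ℝ)}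
    {x₀ x₁ u₀ u₁ z₀ z₁ Z₀ Z₁ : ℝ} (hu₀ : u₀ ≤ x₀) (hx : x₀ ≤ x₁) (hu₁ : x₁ ≤ u₁) (hZ₀ : Z₀ ≤ z₀)
    (hz : z₀ ≤ z₁) (hZ₁ : z₁ ≤ Z₁) (hzu : z₁ - z₀ ≤ 3 * (u₁ - u₀)) (hxZ : x₁ - x₀ ≤ 3 * (Z₁ - Z₀))
    (hμ : IsCarried μ f g x₀ x₁ z₀ z₁) (hmass : μ univ = n) :
    HasFatPartition μ n (coordBox f g u₀ u₁ Z₀ Z₁)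
      (_root_.crossBound f g x₀ x₁ u₀ u₁ z₀ z₁ Z₀ Z₁) := by
  rcases le_or_gt (x₁ - x₀) (3 * (z₁ - z₀)) with hc | hc
  · obtain ⟨v₀, v₁, hv₀, hvx₀, hvx₁, hv₁, hv⟩ := exists_intermediate_interval hu₀ hu₁
      (le_max_left (x₁ - x₀) ((z₁ - z₀) / 3)) (max_le (by linarith) (by linarith))
    have hv_ge := le_max_right (x₁ - x₀) ((z₁ - z₀) / 3)
    have hv_le : max (x₁ - x₀) ((z₁ - z₀) / 3) ≤ 3 * (z₁ - z₀) := max_le hc (by linarith)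
    refine (h hfg hvx₀ hx hvx₁ hz (by linarith) (by linarith) hμ hmass).mono
      (coordBox_subset hv₀ hv₁ hZ₀ hZ₁) fun p => ?_
    rw [coverBound_coordBox hfg]
    unfold _root_.crossBound
    split_ifs <;> grind
  · obtain ⟨v₀, v₁, hv₀, hvz₀, hvz₁, hv₁, hv⟩ := exists_intermediate_interval (t := (x₁ - x₀) / 3)
      hZ₀ hZ₁ (by linarith) (by linarith)
    refine (h hfg.symm hvz₀ hz hvz₁ hx (by linarith) (by linarith) hμ.swap hmass).mono
      (coordBox_comm g f v₀ v₁ x₀ x₁ ▸ coordBox_subset hu₀ hu₁ hv₀ hv₁) fun p => ?_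
    rw [coverBound_coordBox hfg.symm]
    unfold _root_.crossBound
    split_ifs <;> grind

/-- Two cuts of a measure of mass `n` along `g`, chosen so that the strip between them has mass `1`
and either is at least a third of the height, or can be merged with the lower part to leave both parts
with between one and two thirds of the height. -/
theorem exists_two_cuts {n : ℕ} (hn : 0 < n) {g : ℝ × ℝ → ℝ} (hg : Measurable g)
    {μ : Measure (ℝ × ℝ)} {y₀ y₁ : ℝ} (hy : y₀ ≤ y₁) (hμ₀ : μ {p | g p < y₀} = 0)
    (hμ₁ : μ {p | y₁ < g p} = 0) (hmass : μ univ = n) :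
    ∃ (j r : ℕ) (c c' : ℝ) (μ₁ μ₂ μ₃ : Measure (ℝ × ℝ)), n = j + (1 + r) ∧
      μ₁ + (μ₂ + μ₃) = μ ∧ μ₁ univ = j ∧ μ₂ univ = 1 ∧ μ₃ univ = r ∧
      μ₁ {p | c < g p} = 0 ∧ μ₂ {p | g p < c} = 0 ∧ μ₃ {p | g p < c} = 0 ∧
      μ₂ {p | c' < g p} = 0 ∧ μ₃ {p | g p < c'} = 0 ∧
      y₀ ≤ c ∧ c ≤ y₀ + (y₁ - y₀) / 3 ∧ c ≤ c' ∧ c' ≤ y₁ ∧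
      (y₁ - (y₁ - y₀) / 3 ≤ c' ∨
        0 < r ∧ y₀ + (y₁ - y₀) / 3 ≤ c' ∧ c' ≤ y₁ - (y₁ - y₀) / 3) := by
  let C : ℕ → Prop := fun j => ∃ (c : ℝ) (μ₁ μ₂ : Measure (ℝ × ℝ)), y₀ ≤ c ∧
    c ≤ y₀ + (y₁ - y₀) / 3 ∧ μ₁ + μ₂ = μ ∧ μ₁ univ = j ∧ μ₁ {p | c < g p} = 0 ∧
    μ₂ {p | g p < c} = 0
  obtain ⟨j, hj, ⟨c, μ₁, ν, hc₀, hc₁, hsum, hm₁, hμ₁c, hνc⟩, hmax⟩ :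
      ∃ j < n, C j ∧ (j + 1 < n → ¬ C (j + 1)) := by
    by_contra! h
    have hall : ∀ j < n, C j := by
      intro j
      induction j with
      | zero => exact fun _ => ⟨y₀, 0, μ, le_rfl, by linarith, by simp, by simp, by simp, hμ₀⟩
      | succ j ih => exact fun hj => (h j (by omega) (ih (by omega))).2
    have := (h (n - 1) (by omega) (hall _ (by omega))).1
    omega
  obtain ⟨r, rfl⟩ : ∃ r, n = j + (1 + r) := ⟨n - (j + 1), by omega⟩
  have hν : ν univ = 1 + r := by
    have h : μ₁ univ + ν univ = j + (1 + r) := by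
      rw [← Measure.add_apply, hsum, hmass]; push_cast; rfl
    rw [hm₁] at h
    exact (ENNReal.add_right_inj (ENNReal.natCast_ne_top j)).1 h
  have hνle : ν ≤ μ := hsum ▸ Measure.le_add_left le_rfl
  have hνy₁ : ν {p | y₁ < g p} = 0 := le_zero_iff.1 (hμ₁ ▸ hνle _)
  rcases Nat.eq_zero_or_pos r with rfl | hr
  · exact ⟨j, 0, c, y₁, μ₁, ν, 0, rfl, by simpa using hsum, hm₁, by simpa using hν, by simp, hμ₁c, hνc,
      by simp, hνy₁, by simp, hc₀, hc₁, by linarith, le_rfl, Or.inl (by linarith)⟩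
  have : IsFiniteMeasure ν := ⟨by rw [hν]; exact_mod_cast ENNReal.natCast_lt_top (1 + r)⟩
  obtain ⟨c', hcc', hc', μ₂, μ₃, hsum', hm₂, hμ₂c', hμ₃c'⟩ :=
    exists_levelCut ν hg (by linarith : c ≤ y₁) hνc hνy₁ (m := 1) (hν ▸ le_self_add)
  have hm₃ : μ₃ univ = r := by
    have h : μ₂ univ + μ₃ univ = 1 + r := by rw [← Measure.add_apply, hsum', hν]
    rw [hm₂] at h
    exact (ENNReal.add_right_inj ENNReal.one_ne_top).1 h
  have hμ₂le : μ₂ ≤ ν := hsum' ▸ Measure.le_add_right le_rfl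
  have hμ₃le : μ₃ ≤ ν := hsum' ▸ Measure.le_add_left le_rfl
  refine ⟨j, r, c, c', μ₁, μ₂, μ₃, rfl, by rw [hsum', hsum], hm₁, hm₂, hm₃, hμ₁c,
    le_zero_iff.1 (hνc ▸ hμ₂le _), le_zero_iff.1 (hνc ▸ hμ₃le _), hμ₂c', hμ₃c', hc₀, hc₁, hcc', hc', ?_⟩
  by_contra! hlow
  have hlow' : c' < y₀ + (y₁ - y₀) / 3 := by
    by_contra! h
    linarith [hlow.2 hr h]
  refine hmax (by omega) ⟨c', μ₁ + μ₂, μ₃, by linarith, hlow'.le, by rw [add_assoc, hsum', hsum], ?_,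
    ?_, hμ₃c'⟩
  · rw [Measure.add_apply, hm₁, hm₂]; push_cast; rfl
  · rw [Measure.add_apply, hμ₂c', add_zero]
    exact measure_mono_null (fun _ hp => lt_of_le_of_lt hcc' hp) hμ₁c

theorem crossBound_add_indicator_add_crossBound_le {f g : ℝ × ℝ → ℝ} (hfg : IsCoordPair f g)
    {x₀ x₁ u₀ u₁ y₀ y₁ c c' : ℝ} (hc₀ : y₀ ≤ c) (hc₁ : c ≤ y₀ + (y₁ - y₀) / 3) (hcase : y₁ - (y₁ - y₀) / 3 ≤ c') (hc' : c' ≤ y₁) (p : ℝ × ℝ) :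
    crossBound f g x₀ x₁ u₀ u₁ y₀ c y₀ (y₀ + (y₁ - y₀) / 3) p +
      ((interior (coordBox f g u₀ u₁ c c')).indicator (fun _ => 1) p +
        crossBound f g x₀ x₁ u₀ u₁ c' y₁ (y₁ - (y₁ - y₀) / 3) y₁ p) ≤
      coverBound (coordBox f g x₀ x₁ y₀ y₁) (coordBox f g u₀ u₁ y₀ y₁) p := by
  classical
  rw [coverBound_coordBox hfg]
  simp only [indicator_apply, mem_interior_coordBox hfg, crossBound]
  generalize f p = s at *
  generalize g p = t at *
  split_ifs <;> grind

theorem hasFatPartition_of_width_le {n : ℕ} (hn : 0 < n)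
    (ih : ∀ m < n, PartitionsInExtensions m) {f g : ℝ × ℝ → ℝ} (hfg : IsCoordPair f g)
    {μ : Measure (ℝ × ℝ)} {x₀ x₁ u₀ u₁ y₀ y₁ : ℝ} (hu₀ : u₀ ≤ x₀) (hx : x₀ ≤ x₁) (hu₁ : x₁ ≤ u₁)
    (hy : y₀ ≤ y₁) (huy : u₁ - u₀ ≤ y₁ - y₀) (hyu : y₁ - y₀ ≤ 3 * (u₁ - u₀))
    (hμ : IsCarried μ f g x₀ x₁ y₀ y₁) (hmass : μ univ = n) :
    HasFatPartition μ n (coordBox f g u₀ u₁ y₀ y₁)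
      (coverBound (coordBox f g x₀ x₁ y₀ y₁) (coordBox f g u₀ u₁ y₀ y₁)) := by
  obtain ⟨j, r, c, c', μ₁, μ₂, μ₃, rfl, rfl, hm₁, hm₂, hm₃, hμ₁c, hμ₂c, hμ₃c, hμ₂c', hμ₃c', hc₀, hc₁,
    hcc', hc', hcase⟩ := exists_two_cuts hn hfg.symm.measurable hy hμ.3 hμ.4 hmass
  have hμ₁ := hμ.mono_measure (Measure.le_add_right le_rfl : μ₁ ≤ _)
  have hμ₂ := hμ.mono_measure (Measure.le_add_left (Measure.le_add_right le_rfl) : μ₂ ≤ _)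
  have hμ₃ := hμ.mono_measure (Measure.le_add_left (Measure.le_add_left le_rfl) : μ₃ ≤ _)
  rcases hcase with hcase | ⟨hr, hlow, hhigh⟩
  · have h₁ := (ih j (by omega)).crossBound hfg (Z₀ := y₀) (Z₁ := y₀ + (y₁ - y₀) / 3) hu₀ hx hu₁
      le_rfl hc₀ hc₁ (by linarith) (by linarith) ⟨hμ₁.1, hμ₁.2, hμ₁.3, hμ₁c⟩ hm₁
    have h₂ := HasFatPartition.single
      (isFatRect_coordBox hfg (by linarith : u₀ ≤ u₁) hcc' (by linarith) (by linarith))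
      (IsCarried.compl_coordBox ⟨hμ₂.1, hμ₂.2, hμ₂c, hμ₂c'⟩ hu₀ hu₁) hm₂
    have h₃ := (ih r (by omega)).crossBound hfg (Z₀ := y₁ - (y₁ - y₀) / 3) (Z₁ := y₁) hu₀ hx hu₁
      hcase hc' le_rfl (by linarith) (by linarith) ⟨hμ₃.1, hμ₃.2, hμ₃c', hμ₃.4⟩ hm₃
    replace h₁ := h₁.mono (coordBox_subset (c' := y₀) (d' := y₁) le_rfl le_rfl le_rfl (by linarith))
      fun _ => le_rfl
    replace h₂ := h₂.mono (coordBox_subset (c' := y₀) (d' := y₁) le_rfl le_rfl hc₀ hc')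
      fun _ => le_rfl
    replace h₃ := h₃.mono (coordBox_subset (c' := y₀) (d' := y₁) le_rfl le_rfl (by linarith) le_rfl)
      fun _ => le_rfl
    refine (h₁.add (h₂.add h₃ hfg.symm hμ₂c' hμ₃c') hfg.symm hμ₁c ?_).mono subset_rfl fun p => ?_
    · rw [Measure.add_apply, hμ₂c, hμ₃c, add_zero]
    · exact crossBound_add_indicator_add_crossBound_le hfg hc₀ hc₁ hcase hc' p
  · have h₁ := (ih (j + 1) (by omega)).crossBound hfg (μ := μ₁ + μ₂) (Z₀ := y₀) (Z₁ := c')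
      (z₀ := y₀) (z₁ := c') hu₀ hx hu₁
      le_rfl (by linarith) le_rfl (by linarith) (by linarith)
      ⟨by simp [hμ₁.1, hμ₂.1], by simp [hμ₁.2, hμ₂.2], by simp [hμ₁.3, hμ₂.3], by
        rw [Measure.add_apply, hμ₂c', add_zero]
        exact measure_mono_null (fun _ hp => lt_of_le_of_lt hcc' hp) hμ₁c⟩
      (by rw [Measure.add_apply, hm₁, hm₂]; push_cast; rfl)
    have h₃ := (ih r (by omega)).crossBound hfg (Z₀ := c') (Z₁ := y₁) hu₀ hx hu₁
      le_rfl hc' le_rfl (by linarith) (by linarith) ⟨hμ₃.1, hμ₃.2, hμ₃c', hμ₃.4⟩ hm₃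
    replace h₁ := h₁.mono (coordBox_subset (c' := y₀) (d' := y₁) le_rfl le_rfl le_rfl hc')
      fun _ => le_rfl
    replace h₃ := h₃.mono (coordBox_subset (c' := y₀) (d' := y₁) le_rfl le_rfl (by linarith) le_rfl)
      fun _ => le_rfl
    rw [← add_assoc, ← add_assoc]
    refine (h₁.add h₃ hfg.symm (c := c') ?_ hμ₃c').mono subset_rfl fun p => ?_
    · rw [Measure.add_apply, hμ₂c', add_zero]
      exact measure_mono_null (fun _ hp => lt_of_le_of_lt hcc' hp) hμ₁c
    · rw [coverBound_coordBox hfg]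
      simp only [Pi.add_apply, crossBound]
      split_ifs <;> grind

theorem partitionsInExtensions (n : ℕ) : PartitionsInExtensions n := by
  induction n using Nat.strong_induction_on with
  | _ n ih =>
    intro f g hfg μ x₀ x₁ u₀ u₁ y₀ y₁ hu₀ hx hu₁ hy huy hyu hμ hmass
    rcases Nat.eq_zero_or_pos n with rfl | hn
    · exact .of_measure_univ_eq_zero (by simpa using hmass)
    rcases le_or_gt (u₁ - u₀) (y₁ - y₀) with h | h
    · exact hasFatPartition_of_width_le hn ih hfg hu₀ hx hu₁ hy h hyu hμ hmass
    rcases le_or_gt (x₁ - x₀) (y₁ - y₀) with h' | h'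
    · obtain ⟨v₀, v₁, hv₀, hvx₀, hvx₁, hv₁, hv⟩ := exists_intermediate_interval hu₀ hu₁ h' h.le
      have hsub : coordBox f g v₀ v₁ y₀ y₁ ⊆ coordBox f g u₀ u₁ y₀ y₁ :=
        coordBox_subset hv₀ hv₁ le_rfl le_rfl
      exact (hasFatPartition_of_width_le hn ih hfg hvx₀ hx hvx₁ hy hv.le (by linarith) hμ hmass).mono
        hsub (coverBound_mono hsub)
    · have hsub : coordBox f g x₀ x₁ y₀ y₁ ⊆ coordBox f g u₀ u₁ y₀ y₁ :=
        coordBox_subset hu₀ hu₁ le_rfl le_rfl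
      have key := hasFatPartition_of_width_le hn ih hfg.symm le_rfl hy le_rfl hx h'.le (by linarith)
        hμ.swap hmass
      rw [coordBox_comm g f] at key
      exact key.mono hsub (coverBound_mono hsub)

end

/-- Yulmukhametov's theorem on partition of measures (Theorem C / Theorem `t:ge`):
a measure of positive integer mass `N` on a square `Π`, whose atoms of fractional mass are
suitably placed with respect to axis-parallel lines, can be partitioned into `N` measures of
mass `1` supported on axis-parallel rectangles with side ratio in `[1/3, 3]`, with pairwise
disjoint interiors of convex hulls of supports, and covering multiplicity at most `4`. -/
theorem stmt5 (μ : Measure (ℝ × ℝ)) [IsFiniteMeasure μ] (x y s : ℝ) (hs : 0 < s)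
    (Sq : Set (ℝ × ℝ)) (hSq : Sq = Set.Icc (x, y) (x + s, y + s))
    (hsupp : μ Sqᶜ = 0)
    (N : ℕ) (hN : 0 < N) (hmass : μ Sq = N)
    (hline : ∀ L : Set (ℝ × ℝ),
      ((∃ c : ℝ, L = {p : ℝ × ℝ | p.1 = c}) ∨ (∃ c : ℝ, L = {p : ℝ × ℝ | p.2 = c})) →
      (∀ p q : ℝ × ℝ, p ∈ L → q ∈ L → 0 < μ {p} → μ {p} < 1 → 0 < μ {q} → μ {q} < 1 → p = q) ∧
      (∀ p ∈ L, 0 < μ {p} → μ {p} < 1 → μ (L \ {p}) = 0)) :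
    ∃ (a b : Fin N → ℝ × ℝ) (ν : Fin N → Measure (ℝ × ℝ)),
      (∀ k, a k ≤ b k) ∧
      (∀ k, Set.Icc (a k) (b k) ⊆ Sq) ∧
      -- (1) supports
      (∀ k, measSupport (ν k) ⊆ Set.Icc (a k) (b k)) ∧
      -- (2) masses and sum
      (∀ k, ν k (Set.Icc (a k) (b k)) = 1) ∧ (∑ k, ν k) = μ ∧
      -- (3) disjoint interiors of convex hulls of supports
      (∀ k l, k ≠ l →
        Disjoint (interior (convexHull ℝ (measSupport (ν k))))
          (interior (convexHull ℝ (measSupport (ν l))))) ∧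
      -- (4) side ratio in [1/3, 3]
      (∀ k, (b k).1 - (a k).1 ≤ 3 * ((b k).2 - (a k).2) ∧
        (b k).2 - (a k).2 ≤ 3 * ((b k).1 - (a k).1)) ∧
      -- (5) covering multiplicity at most 4
      (∀ p : ℝ × ℝ, {k : Fin N | p ∈ interior (Set.Icc (a k) (b k))}.ncard ≤ 4) := by
  subst hSq
  have hnull : ∀ t ⊆ (Set.Icc (x, y) (x + s, y + s))ᶜ, μ t = 0 :=
    fun t ht => measure_mono_null ht hsupp
  have hcarried : IsCarried μ Prod.fst Prod.snd x (x + s) y (y + s) :=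
    ⟨hnull _ fun p hp h => not_le.2 hp h.1.1, hnull _ fun p hp h => not_le.2 hp h.2.1,
      hnull _ fun p hp h => not_le.2 hp h.1.2, hnull _ fun p hp h => not_le.2 hp h.2.2⟩
  have huniv : μ Set.univ = N := by
    rw [← measure_add_measure_compl (measurableSet_Icc : MeasurableSet (Set.Icc (x, y) (x + s, y + s))),
      hsupp, add_zero, hmass]
  have hbox : coordBox Prod.fst Prod.snd x (x + s) y (y + s) = Set.Icc (x, y) (x + s, y + s) := by
    ext p
    simp only [mem_coordBox, Set.mem_Icc, Prod.le_def]
    tauto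
  obtain ⟨ι, _, P, ν, hcard, hP, hsum, hsep, hmult⟩ :=
    partitionsInExtensions N (Or.inl ⟨rfl, rfl⟩) le_rfl (by linarith) le_rfl (by linarith)
      (by linarith) (by linarith) hcarried huniv
  rw [hbox] at hP
  choose hfat hPsub hPnull hνuniv using hP
  choose a b hab hPab hratio using hfat
  subst hcard
  set e := (Fintype.equivFin ι).symm
  have hPe : ∀ k, Set.Icc (a (e k)) (b (e k)) = P (e k) := fun k => (hPab _).symm
  refine ⟨a ∘ e, b ∘ e, ν ∘ e, fun k => hab _, fun k => ?_, fun k => ?_, fun k => ?_, ?_,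
    fun k l hkl => ?_, fun k => hratio _, fun p => ?_⟩
  · exact (hPe k).trans_subset (hPsub _)
  · exact measSupport_subset_of_isClosed isClosed_Icc ((hPe k).symm ▸ hPnull _)
  · have h := measure_add_measure_compl (μ := ν (e k))
      (measurableSet_Icc : MeasurableSet (Set.Icc (a (e k)) (b (e k))))
    rw [hPe, hPnull, add_zero, hνuniv] at h
    simpa only [Function.comp_apply, hPe] using h
  · rw [← hsum]
    exact e.sum_comp ν
  · exact (hsep (e.injective.ne hkl)).disjoint_interior_convexHull
  · classical
    have hcount : {k | p ∈ interior (Set.Icc ((a ∘ e) k) ((b ∘ e) k))}.ncard =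
        ∑ k, (interior (P k)).indicator (fun _ => 1) p := by
      rw [← e.sum_comp, Set.ncard_eq_toFinset_card', Finset.card_eq_sum_ones]
      simp only [Set.indicator_apply, ← hPe, Function.comp_apply]
      rw [← Finset.sum_filter]
      congr 1
      ext k
      simp
    rw [hcount]
    refine (hmult p).trans ?_
    unfold coverBound
    split_ifs <;> norm_num
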